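/- Let H_θ, for θ ∈ R/Z, be the Hilbert space of locally L² functions f : R → C with f(t+1) = e^{2πiθ} f(t), forming a continuous field of Hilbert spaces ℍ → S¹ (trivialized by restriction to (0,1)). Let λ̃ : S^m(S¹) → C^∞(S¹, B(ℍ)) be defined by λ̃(a) := λ(F₂(a)), where F₂ is the Fourier transform in the fiber (second) variable of a symbol on T*S¹ = S¹ × R and λ_θ(b)f(t) = ∫_R b(t, t−r) f(r) dr for f ∈ H_θ. Then λ̃ is multiplicative up to lower order terms: for a ∈ S^m(S¹) and b ∈ S^{m'}(S¹) (m, m' ≤ 0) one has λ̃(ab) − λ̃(a)λ̃(b) ∈ λ̃(S^{m+m'−1}(S¹)). -/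

import Mathlib

/-!
STATEMENT 10.  T-duality on the circle: the quantization
`λ̃ : S^m(S¹) → C^∞(S¹, B(ℍ))`, `λ̃(a) = λ(𝓕₂ a)`, is multiplicative up to lower order
terms: for `a ∈ S^m(S¹)` and `b ∈ S^{m'}(S¹)` (`m, m' ≤ 0`) one has
`λ̃(ab) − λ̃(a) λ̃(b) ∈ λ̃(S^{m+m'−1}(S¹))`.

Concretely, the continuous field `(H_θ)` is trivialised by restriction to `(0,1)`, so all
operators act on `L²(0,1)`; in this trivialization, `λ̃_θ(a)` is the operator determined by

  `λ̃_θ(a) e_k^θ = a(·, 2π(k+θ)) · e_k^θ`,  where `e_k^θ(t) = e^{2πi(k+θ)t}`,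

which is the formula obtained in the paper by expanding `f ∈ H_θ` in a Fourier series.
Symbols in the Hörmander class `S^m(S¹)` are `1`-periodic symbols on `ℝ × ℝ`.
-/

noncomputable section

open MeasureTheory Topology Real

noncomputable def dirDeriv {V W : Type*} [NormedAddCommGroup V] [NormedSpace ℝ V]
    [NormedAddCommGroup W] [NormedSpace ℝ W] (v : V) (f : V → W) : V → W :=
  fun z => fderiv ℝ f z v

noncomputable def multiDeriv {V W : Type*} [NormedAddCommGroup V] [NormedSpace ℝ V]
    [NormedAddCommGroup W] [NormedSpace ℝ W] (vs : List V) (f : V → W) : V → W :=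
  vs.foldr dirDeriv f

/-- The Hörmander class `S^m(S¹)` of symbols of order `m` on the circle `S¹ = ℝ/ℤ`,
viewed as `1`-periodic functions on `T*ℝ = ℝ × ℝ`. -/
structure IsCircleSymbol (m : ℝ) (a : ℝ × ℝ → ℂ) : Prop where
  smooth : ContDiff ℝ (⊤ : ℕ∞) a
  periodic : ∀ t u : ℝ, a (t + 1, u) = a (t, u)
  est : ∀ β α : ℕ, ∃ C : ℝ, ∀ z : ℝ × ℝ,
    ‖multiDeriv (List.replicate β ((1:ℝ), (0:ℝ)) ++ List.replicate α ((0:ℝ), (1:ℝ))) a z‖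
      ≤ C * (1 + |z.2|) ^ (m - (α : ℝ))

/-- `L²(0,1)`, the common model of the fibers `H_θ` of the field `ℍ → S¹` (an element of
`H_θ` is recovered from its restriction to `(0,1)` by `f(t+1) = e^{2πiθ} f(t)`). -/
abbrev L2I := Lp ℂ 2 ((volume : Measure ℝ).restrict (Set.Ioo (0:ℝ) 1))

/-- `g` represents the basis vector `e_k^θ(t) = e^{2πi(k+θ)t}` of `H_θ` in `L²(0,1)`. -/
def RepsExp (θ : ℝ) (k : ℤ) (g : L2I) : Prop :=
  ∀ᵐ t ∂((volume : Measure ℝ).restrict (Set.Ioo (0:ℝ) 1)),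
    (g : ℝ → ℂ) t = Complex.exp (2 * (π : ℂ) * Complex.I * ((k : ℂ) + (θ : ℂ)) * (t : ℂ))

/-- `A = λ̃(a)`: in the trivialization of `ℍ`, the operator `A θ = λ̃_θ(a) ∈ B(H_θ)` is
determined on the orthonormal basis `(e_k^θ)_{k∈ℤ}` of `H_θ` by
`λ̃_θ(a) e_k^θ = a(·, 2π(k+θ)) e_k^θ`. -/
def IsLambdaTilde (a : ℝ × ℝ → ℂ) (A : ℝ → (L2I →L[ℂ] L2I)) : Prop :=
  ∀ (θ : ℝ) (k : ℤ) (g : L2I), RepsExp θ k g →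
    ∀ᵐ t ∂((volume : Measure ℝ).restrict (Set.Ioo (0:ℝ) 1)),
      (A θ g : ℝ → ℂ) t
        = a (t, 2 * π * ((k : ℝ) + θ)) *
            Complex.exp (2 * (π : ℂ) * Complex.I * ((k : ℂ) + (θ : ℂ)) * (t : ℂ))

section Derivatives

variable {V W : Type*} [NormedAddCommGroup V] [NormedSpace ℝ V]
  [NormedAddCommGroup W] [NormedSpace ℝ W]

theorem contDiff_dirDeriv {f : V → W} (hf : ContDiff ℝ (⊤ : ℕ∞) f) (v : V) :
    ContDiff ℝ (⊤ : ℕ∞) (dirDeriv v f) :=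
  (hf.fderiv_right (by simp)).clm_apply contDiff_const

theorem contDiff_multiDeriv {f : V → W} (hf : ContDiff ℝ (⊤ : ℕ∞) f) (vs : List V) :
    ContDiff ℝ (⊤ : ℕ∞) (multiDeriv vs f) := by
  induction vs with
  | nil => exact hf
  | cons v vs ih => exact contDiff_dirDeriv ih v

theorem dirDeriv_comm {f : V → W} (hf : ContDiff ℝ (⊤ : ℕ∞) f) (v w : V) :
    dirDeriv v (dirDeriv w f) = dirDeriv w (dirDeriv v f) := by
  have hd : Differentiable ℝ (fderiv ℝ f) :=
    (hf.fderiv_right (m := (⊤ : ℕ∞)) (by simp)).differentiable (by simp)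
  have key : ∀ (v w : V) (z : V),
      dirDeriv v (dirDeriv w f) z = fderiv ℝ (fderiv ℝ f) z v w := by
    intro v w z
    have := (hd z).hasFDerivAt.clm_apply (hasFDerivAt_const w z)
    change fderiv ℝ (fun y => fderiv ℝ f y w) z v = _
    simp [this.fderiv]
  funext z
  rw [key, key]
  exact ((contDiff_infty.1 hf 2).contDiffAt.isSymmSndFDerivAt (by simp)).eq v w

theorem dirDeriv_multiDeriv {f : V → W} (hf : ContDiff ℝ (⊤ : ℕ∞) f) (v : V) (vs : List V) :
    dirDeriv v (multiDeriv vs f) = multiDeriv vs (dirDeriv v f) := by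
  induction vs with
  | nil => rfl
  | cons w vs ih =>
    change dirDeriv v (dirDeriv w (multiDeriv vs f)) = dirDeriv w (multiDeriv vs (dirDeriv v f))
    rw [dirDeriv_comm (contDiff_multiDeriv hf vs), ih]

theorem dirDeriv_add {f g : V → W} (hf : ContDiff ℝ (⊤ : ℕ∞) f) (hg : ContDiff ℝ (⊤ : ℕ∞) g)
    (v : V) : dirDeriv v (f + g) = dirDeriv v f + dirDeriv v g := by
  funext z
  simp [dirDeriv, fderiv_add (hf.differentiable (by simp) z) (hg.differentiable (by simp) z)]

theorem multiDeriv_add {f g : V → W} (hf : ContDiff ℝ (⊤ : ℕ∞) f) (hg : ContDiff ℝ (⊤ : ℕ∞) g)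
    (vs : List V) : multiDeriv vs (f + g) = multiDeriv vs f + multiDeriv vs g := by
  induction vs with
  | nil => rfl
  | cons v vs ih =>
    change dirDeriv v (multiDeriv vs (f + g)) = _
    rw [ih, dirDeriv_add (contDiff_multiDeriv hf vs) (contDiff_multiDeriv hg vs)]
    rfl

theorem dirDeriv_sub {f g : V → W} (hf : ContDiff ℝ (⊤ : ℕ∞) f) (hg : ContDiff ℝ (⊤ : ℕ∞) g)
    (v : V) : dirDeriv v (f - g) = dirDeriv v f - dirDeriv v g := by
  funext z
  simp [dirDeriv, fderiv_sub (hf.differentiable (by simp) z) (hg.differentiable (by simp) z)]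

theorem multiDeriv_sub {f g : V → W} (hf : ContDiff ℝ (⊤ : ℕ∞) f) (hg : ContDiff ℝ (⊤ : ℕ∞) g)
    (vs : List V) : multiDeriv vs (f - g) = multiDeriv vs f - multiDeriv vs g := by
  induction vs with
  | nil => rfl
  | cons v vs ih =>
    change dirDeriv v (multiDeriv vs (f - g)) = _
    rw [ih, dirDeriv_sub (contDiff_multiDeriv hf vs) (contDiff_multiDeriv hg vs)]
    rfl

theorem multiDeriv_comp_add_right (f : V → W) (w : V) (vs : List V) :
    multiDeriv vs (fun z => f (z + w)) = fun z => multiDeriv vs f (z + w) := by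
  induction vs with
  | nil => rfl
  | cons v vs ih =>
    change dirDeriv v (multiDeriv vs _) = _
    rw [ih]
    funext z
    simp only [dirDeriv, fderiv_comp_add_right]
    rfl

theorem dirDeriv_mul {f g : V → ℂ} (hf : ContDiff ℝ (⊤ : ℕ∞) f) (hg : ContDiff ℝ (⊤ : ℕ∞) g)
    (v : V) : dirDeriv v (f * g) = dirDeriv v f * g + f * dirDeriv v g := by
  funext z
  simp [dirDeriv, fderiv_mul (hf.differentiable (by simp) z) (hg.differentiable (by simp) z)]
  ring

end Derivatives

/-- `∂ₜ^β ∂ᵤ^α f` for a function `f` of `(t, u)`. -/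
def mixedDeriv (β α : ℕ) (f : ℝ × ℝ → ℂ) : ℝ × ℝ → ℂ :=
  multiDeriv (List.replicate β ((1:ℝ), (0:ℝ)) ++ List.replicate α ((0:ℝ), (1:ℝ))) f

theorem mixedDeriv_zero_zero (f : ℝ × ℝ → ℂ) : mixedDeriv 0 0 f = f := rfl

theorem contDiff_mixedDeriv {f : ℝ × ℝ → ℂ} (hf : ContDiff ℝ (⊤ : ℕ∞) f) (β α : ℕ) :
    ContDiff ℝ (⊤ : ℕ∞) (mixedDeriv β α f) :=
  contDiff_multiDeriv hf _

theorem mixedDeriv_succ_left (β α : ℕ) (f : ℝ × ℝ → ℂ) :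
    mixedDeriv (β + 1) α f = dirDeriv (1, 0) (mixedDeriv β α f) := rfl

theorem mixedDeriv_dirDeriv_fst {f : ℝ × ℝ → ℂ} (hf : ContDiff ℝ (⊤ : ℕ∞) f) (β α : ℕ) :
    mixedDeriv β α (dirDeriv (1, 0) f) = mixedDeriv (β + 1) α f :=
  (dirDeriv_multiDeriv hf _ _).symm

theorem mixedDeriv_dirDeriv_snd (β α : ℕ) (f : ℝ × ℝ → ℂ) :
    mixedDeriv β α (dirDeriv (0, 1) f) = mixedDeriv β (α + 1) f := by
  simp only [mixedDeriv, List.replicate_succ', multiDeriv, List.foldr_append, List.foldr_cons,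
    List.foldr_nil]

theorem dirDeriv_snd_mixedDeriv {f : ℝ × ℝ → ℂ} (hf : ContDiff ℝ (⊤ : ℕ∞) f) (β α : ℕ) :
    dirDeriv (0, 1) (mixedDeriv β α f) = mixedDeriv β (α + 1) f := by
  rw [← mixedDeriv_dirDeriv_snd]
  exact dirDeriv_multiDeriv hf _ _

theorem fderiv_eq_dirDeriv (f : ℝ × ℝ → ℂ) (z : ℝ × ℝ) :
    fderiv ℝ f z = (ContinuousLinearMap.fst ℝ ℝ ℝ).smulRight (dirDeriv (1, 0) f z)
      + (ContinuousLinearMap.snd ℝ ℝ ℝ).smulRight (dirDeriv (0, 1) f z) := by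
  ext <;> simp [dirDeriv]

/-- A class of differentiable functions closed under partial derivatives consists of smooth
functions. -/
theorem contDiff_of_closed_dirDeriv {S : Set (ℝ × ℝ → ℂ)}
    (hS : ∀ f ∈ S, Differentiable ℝ f ∧ dirDeriv (1, 0) f ∈ S ∧ dirDeriv (0, 1) f ∈ S)
    {f : ℝ × ℝ → ℂ} (hf : f ∈ S) : ContDiff ℝ (⊤ : ℕ∞) f := by
  rw [contDiff_infty]
  intro n
  induction n generalizing f with
  | zero => exact contDiff_zero.2 (hS f hf).1.continuous
  | succ n ih =>
    have h := hS f hf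
    push_cast
    rw [contDiff_succ_iff_fderiv]
    refine ⟨h.1, by simp, ?_⟩
    rw [funext (fderiv_eq_dirDeriv f)]
    exact (contDiff_const.smulRight (ih h.2.1)).add (contDiff_const.smulRight (ih h.2.2))

/-- A family of symbols of order `m` whose seminorms grow at most polynomially. -/
structure ModerateFamily (m : ℝ) (f : ℤ → ℝ × ℝ → ℂ) : Prop where
  smooth : ∀ l, ContDiff ℝ (⊤ : ℕ∞) (f l)
  est : ∀ β α : ℕ, ∃ C : ℝ, ∃ N : ℕ, ∀ (l : ℤ) (z : ℝ × ℝ),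
    ‖mixedDeriv β α (f l) z‖ ≤ C * (1 + |(l : ℝ)|) ^ N * (1 + |z.2|) ^ (m - (α : ℝ))

/-- A family of symbols of order `m` whose seminorms decay faster than any power. -/
structure RapidFamily (m : ℝ) (f : ℤ → ℝ × ℝ → ℂ) : Prop where
  smooth : ∀ l, ContDiff ℝ (⊤ : ℕ∞) (f l)
  est : ∀ β α N : ℕ, ∃ C : ℝ, ∀ (l : ℤ) (z : ℝ × ℝ),
    (1 + |(l : ℝ)|) ^ N * ‖mixedDeriv β α (f l) z‖ ≤ C * (1 + |z.2|) ^ (m - (α : ℝ))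

namespace ModerateFamily

variable {m : ℝ} {f : ℤ → ℝ × ℝ → ℂ}

theorem dirDeriv_fst (hf : ModerateFamily m f) :
    ModerateFamily m (fun l => dirDeriv (1, 0) (f l)) where
  smooth l := contDiff_dirDeriv (hf.smooth l) _
  est β α := by
    simp only [mixedDeriv_dirDeriv_fst (hf.smooth _)]
    exact hf.est (β + 1) α

theorem dirDeriv_snd (hf : ModerateFamily m f) :
    ModerateFamily (m - 1) (fun l => dirDeriv (0, 1) (f l)) where
  smooth l := contDiff_dirDeriv (hf.smooth l) _
  est β α := by
    simp only [mixedDeriv_dirDeriv_snd]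
    have := hf.est β (α + 1)
    rwa [show m - ((α + 1 : ℕ) : ℝ) = m - 1 - α by push_cast; ring] at this

end ModerateFamily

namespace RapidFamily

variable {m m' : ℝ} {f g : ℤ → ℝ × ℝ → ℂ}

theorem dirDeriv_fst (hf : RapidFamily m f) :
    RapidFamily m (fun l => dirDeriv (1, 0) (f l)) where
  smooth l := contDiff_dirDeriv (hf.smooth l) _
  est β α := by
    simp only [mixedDeriv_dirDeriv_fst (hf.smooth _)]
    exact hf.est (β + 1) α

theorem dirDeriv_snd (hf : RapidFamily m f) :
    RapidFamily (m - 1) (fun l => dirDeriv (0, 1) (f l)) where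
  smooth l := contDiff_dirDeriv (hf.smooth l) _
  est β α := by
    simp only [mixedDeriv_dirDeriv_snd]
    have := hf.est β (α + 1)
    rwa [show m - ((α + 1 : ℕ) : ℝ) = m - 1 - α by push_cast; ring] at this

theorem est_add (hf : ∀ l, ContDiff ℝ (⊤ : ℕ∞) (f l)) (hg : ∀ l, ContDiff ℝ (⊤ : ℕ∞) (g l))
    {β α N : ℕ} {r : ℝ}
    (hfe : ∃ C : ℝ, ∀ (l : ℤ) (z : ℝ × ℝ),
      (1 + |(l : ℝ)|) ^ N * ‖mixedDeriv β α (f l) z‖ ≤ C * (1 + |z.2|) ^ r)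
    (hge : ∃ C : ℝ, ∀ (l : ℤ) (z : ℝ × ℝ),
      (1 + |(l : ℝ)|) ^ N * ‖mixedDeriv β α (g l) z‖ ≤ C * (1 + |z.2|) ^ r) :
    ∃ C : ℝ, ∀ (l : ℤ) (z : ℝ × ℝ),
      (1 + |(l : ℝ)|) ^ N * ‖mixedDeriv β α (f l + g l) z‖ ≤ C * (1 + |z.2|) ^ r := by
  obtain ⟨C, hC⟩ := hfe
  obtain ⟨C', hC'⟩ := hge
  refine ⟨C + C', fun l z => ?_⟩
  rw [mixedDeriv, multiDeriv_add (hf l) (hg l), add_mul]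
  refine le_trans ?_ (add_le_add (hC l z) (hC' l z))
  rw [← mul_add]
  exact mul_le_mul_of_nonneg_left (norm_add_le _ _) (by positivity)

theorem mul_moderate (hf : RapidFamily m f) (hg : ModerateFamily m' g) :
    RapidFamily (m + m') (fun l => f l * g l) where
  smooth l := (hf.smooth l).mul (hg.smooth l)
  est β α N := by
    induction α generalizing m m' f g with
    | zero =>
      induction β generalizing f g with
      | zero =>
        obtain ⟨C', M, hC'⟩ := hg.est 0 0
        obtain ⟨C, hC⟩ := hf.est 0 0 (N + M)
        refine ⟨C * C', fun l z => ?_⟩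
        have h1 := hC l z
        have h2 := hC' l z
        simp only [mixedDeriv_zero_zero, Nat.cast_zero, sub_zero, Pi.mul_apply, norm_mul]
          at h1 h2 ⊢
        have hl : (0:ℝ) < (1 + |(l : ℝ)|) ^ M := by positivity
        have hz : 0 < 1 + |z.2| := by positivity
        have hC0 : 0 ≤ C * (1 + |z.2|) ^ m := le_trans (by positivity) h1
        rw [rpow_add hz]
        refine le_of_mul_le_mul_right ?_ hl
        calc (1 + |(l : ℝ)|) ^ N * (‖f l z‖ * ‖g l z‖) * (1 + |(l : ℝ)|) ^ M
            = ((1 + |(l : ℝ)|) ^ (N + M) * ‖f l z‖) * ‖g l z‖ := by rw [pow_add]; ring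
          _ ≤ (C * (1 + |z.2|) ^ m) * (C' * (1 + |(l : ℝ)|) ^ M * (1 + |z.2|) ^ m') :=
              mul_le_mul h1 h2 (norm_nonneg _) hC0
          _ = _ := by ring
      | succ β ih =>
        have hfg : ∀ l, ContDiff ℝ (⊤ : ℕ∞) (f l * g l) :=
          fun l => (hf.smooth l).mul (hg.smooth l)
        simp only [← mixedDeriv_dirDeriv_fst (hfg _), dirDeriv_mul (hf.smooth _) (hg.smooth _)]
        exact est_add (fun l => (contDiff_dirDeriv (hf.smooth l) _).mul (hg.smooth l))
          (fun l => (hf.smooth l).mul (contDiff_dirDeriv (hg.smooth l) _))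
          (ih hf.dirDeriv_fst hg) (ih hf hg.dirDeriv_fst)
    | succ α ih =>
      simp only [← mixedDeriv_dirDeriv_snd, dirDeriv_mul (hf.smooth _) (hg.smooth _)]
      have h1 := ih hf.dirDeriv_snd hg
      have h2 := ih hf hg.dirDeriv_snd
      rw [show m - 1 + m' - (α : ℝ) = m + m' - ((α + 1 : ℕ) : ℝ) by push_cast; ring] at h1
      rw [show m + (m' - 1) - (α : ℝ) = m + m' - ((α + 1 : ℕ) : ℝ) by push_cast; ring] at h2
      exact est_add (fun l => (contDiff_dirDeriv (hf.smooth l) _).mul (hg.smooth l))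
        (fun l => (hf.smooth l).mul (contDiff_dirDeriv (hg.smooth l) _)) h1 h2

end RapidFamily

theorem summable_inv_one_add_abs_sq : Summable fun l : ℤ => ((1 + |(l : ℝ)|) ^ 2)⁻¹ := by
  have h := (Real.summable_one_div_int_pow (p := 2)).2 one_lt_two
  refine Summable.of_norm_bounded_eventually h ?_
  filter_upwards [(Set.finite_singleton (0 : ℤ)).compl_mem_cofinite] with l hl
  have hl' : 0 < |(l : ℝ)| := abs_pos.2 (by exact_mod_cast hl)
  rw [norm_of_nonneg (by positivity), one_div, ← sq_abs (l : ℝ)]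
  gcongr
  linarith

theorem norm_fderiv_le_dirDeriv (f : ℝ × ℝ → ℂ) (z : ℝ × ℝ) :
    ‖fderiv ℝ f z‖ ≤ ‖dirDeriv (1, 0) f z‖ + ‖dirDeriv (0, 1) f z‖ := by
  rw [fderiv_eq_dirDeriv]
  refine (norm_add_le _ _).trans ?_
  simp only [ContinuousLinearMap.norm_smulRight_apply]
  gcongr
  · exact mul_le_of_le_one_left (norm_nonneg _) (ContinuousLinearMap.norm_fst_le ..)
  · exact mul_le_of_le_one_left (norm_nonneg _) (ContinuousLinearMap.norm_snd_le ..)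

namespace RapidFamily

variable {m : ℝ} {f : ℤ → ℝ × ℝ → ℂ}

theorem exists_norm_le (hf : RapidFamily m f) (β α : ℕ) :
    ∃ C : ℝ, 0 ≤ C ∧ ∀ (l : ℤ) (z : ℝ × ℝ), ‖mixedDeriv β α (f l) z‖
      ≤ C * (1 + |z.2|) ^ (m - (α : ℝ)) * ((1 + |(l : ℝ)|) ^ 2)⁻¹ := by
  obtain ⟨C, hC⟩ := hf.est β α 2
  refine ⟨C, ?_, fun l z => ?_⟩
  · have h := hC 0 (0, 0)
    simp only [abs_zero, add_zero, one_rpow, mul_one] at h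
    exact le_trans (by positivity) h
  · rw [← div_eq_mul_inv, le_div_iff₀ (by positivity), mul_comm]
    exact hC l z

theorem exists_norm_le_of_nonpos (hf : RapidFamily m f) (hm : m ≤ 0) (β α : ℕ) :
    ∃ C : ℝ, ∀ (l : ℤ) (z : ℝ × ℝ), ‖mixedDeriv β α (f l) z‖
      ≤ C * ((1 + |(l : ℝ)|) ^ 2)⁻¹ := by
  obtain ⟨C, hC0, hC⟩ := hf.exists_norm_le β α
  refine ⟨C, fun l z => (hC l z).trans ?_⟩
  gcongr
  refine mul_le_of_le_one_right hC0 (rpow_le_one_of_one_le_of_nonpos ?_ ?_)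
  · linarith [abs_nonneg z.2]
  · linarith [(Nat.cast_nonneg α : (0:ℝ) ≤ α)]

theorem summable_apply (hf : RapidFamily m f) (z : ℝ × ℝ) : Summable fun l => f l z := by
  obtain ⟨C, -, hC⟩ := hf.exists_norm_le 0 0
  exact Summable.of_norm_bounded (summable_inv_one_add_abs_sq.mul_left _) fun l => hC l z

theorem hasFDerivAt_tsum (hf : RapidFamily m f) (hm : m ≤ 0) (z : ℝ × ℝ) :
    (Summable fun l => fderiv ℝ (f l) z) ∧
    HasFDerivAt (fun z => ∑' l, f l z) (∑' l, fderiv ℝ (f l) z) z := by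
  obtain ⟨C, hC⟩ := hf.exists_norm_le_of_nonpos hm 1 0
  obtain ⟨C', hC'⟩ := hf.exists_norm_le_of_nonpos hm 0 1
  have hu : Summable fun l : ℤ => C * ((1 + |(l : ℝ)|) ^ 2)⁻¹ + C' * ((1 + |(l : ℝ)|) ^ 2)⁻¹ :=
    (summable_inv_one_add_abs_sq.mul_left _).add (summable_inv_one_add_abs_sq.mul_left _)
  have hb : ∀ (l : ℤ) (z : ℝ × ℝ), ‖fderiv ℝ (f l) z‖
      ≤ C * ((1 + |(l : ℝ)|) ^ 2)⁻¹ + C' * ((1 + |(l : ℝ)|) ^ 2)⁻¹ :=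
    fun l z => (norm_fderiv_le_dirDeriv _ _).trans (add_le_add (hC l z) (hC' l z))
  exact ⟨Summable.of_norm_bounded hu fun l => hb l z,
    _root_.hasFDerivAt_tsum hu (fun l z => ((hf.smooth l).differentiable (by simp) z).hasFDerivAt)
      hb (hf.summable_apply 0) z⟩

theorem dirDeriv_tsum (hf : RapidFamily m f) (hm : m ≤ 0) (v : ℝ × ℝ) :
    dirDeriv v (fun z => ∑' l, f l z) = fun z => ∑' l, dirDeriv v (f l) z := by
  funext z
  obtain ⟨hs, hd⟩ := hf.hasFDerivAt_tsum hm z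
  rw [dirDeriv, hd.fderiv]
  exact (ContinuousLinearMap.apply ℝ ℂ v).map_tsum hs

theorem contDiff_tsum (hf : RapidFamily m f) (hm : m ≤ 0) :
    ContDiff ℝ (⊤ : ℕ∞) (fun z => ∑' l, f l z) := by
  refine contDiff_of_closed_dirDeriv
    (S := {F | ∃ m : ℝ, m ≤ 0 ∧ ∃ f, RapidFamily m f ∧ F = fun z => ∑' l, f l z}) ?_
    ⟨m, hm, f, hf, rfl⟩
  rintro _ ⟨m, hm, f, hf, rfl⟩
  exact ⟨fun z => (hf.hasFDerivAt_tsum hm z).2.differentiableAt,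
    ⟨m, hm, _, hf.dirDeriv_fst, hf.dirDeriv_tsum hm _⟩,
    ⟨m - 1, by linarith, _, hf.dirDeriv_snd, hf.dirDeriv_tsum hm _⟩⟩

theorem mixedDeriv_tsum (hf : RapidFamily m f) (hm : m ≤ 0) (β α : ℕ) :
    mixedDeriv β α (fun z => ∑' l, f l z) = fun z => ∑' l, mixedDeriv β α (f l) z := by
  induction α generalizing m f with
  | zero =>
    induction β generalizing f with
    | zero => rfl
    | succ β ih =>
      simp only [← mixedDeriv_dirDeriv_fst (hf.contDiff_tsum hm),
        ← mixedDeriv_dirDeriv_fst (hf.smooth _), hf.dirDeriv_tsum hm]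
      exact ih hf.dirDeriv_fst
  | succ α ih =>
    simp only [← mixedDeriv_dirDeriv_snd, hf.dirDeriv_tsum hm]
    exact ih hf.dirDeriv_snd (by linarith)

theorem isCircleSymbol_tsum (hf : RapidFamily m f) (hm : m ≤ 0)
    (hper : ∀ (l : ℤ) (t u : ℝ), f l (t + 1, u) = f l (t, u)) :
    IsCircleSymbol m (fun z => ∑' l, f l z) where
  smooth := hf.contDiff_tsum hm
  periodic t u := by simp only [hper]
  est β α := by
    obtain ⟨C, -, hC⟩ := hf.exists_norm_le β α
    refine ⟨C * ∑' l : ℤ, ((1 + |(l : ℝ)|) ^ 2)⁻¹, fun z => ?_⟩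
    change ‖mixedDeriv β α _ z‖ ≤ _
    rw [hf.mixedDeriv_tsum hm]
    refine (tsum_of_norm_bounded (summable_inv_one_add_abs_sq.hasSum.mul_left _)
      fun l => hC l z).trans_eq ?_
    ring

end RapidFamily

/-- The `l`-th Fourier mode `f̂ₗ(u) e^{2πilt}` of a function `f(t, u)` that is `1`-periodic in `t`. -/
def fourierMode (l : ℤ) (f : ℝ × ℝ → ℂ) (z : ℝ × ℝ) : ℂ :=
  ∫ s in (0:ℝ)..1, Complex.exp (-(2 * π * Complex.I * l * s)) * f (z + (s, 0))

theorem add_mk_zero_right (z : ℝ × ℝ) (s : ℝ) : z + (s, 0) = (z.1 + s, z.2) := by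
  ext <;> simp

theorem norm_exp_two_pi_I_mul (x y : ℝ) : ‖Complex.exp (2 * π * Complex.I * x * y)‖ = 1 := by
  rw [show (2 * π * Complex.I * x * y : ℂ) = ((2 * π * x * y : ℝ) : ℂ) * Complex.I by
    push_cast; ring]
  exact Complex.norm_exp_ofReal_mul_I _

theorem norm_exp_neg_two_pi_I_mul (l : ℤ) (s : ℝ) :
    ‖Complex.exp (-(2 * π * Complex.I * l * s))‖ = 1 := by
  have := norm_exp_two_pi_I_mul (-l) s
  rw [← this]
  push_cast
  ring_nf

theorem norm_fourierMode_le {f : ℝ × ℝ → ℂ} {M : ℝ} (l : ℤ) (z : ℝ × ℝ)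
    (h : ∀ t, ‖f (t, z.2)‖ ≤ M) : ‖fourierMode l f z‖ ≤ M := by
  have := intervalIntegral.norm_integral_le_of_norm_le_const (a := 0) (b := 1) (C := M)
    (f := fun s : ℝ => Complex.exp (-(2 * π * Complex.I * l * s)) * f (z + (s, 0)))
    (fun s _ => by
      rw [norm_mul, norm_exp_neg_two_pi_I_mul, one_mul]
      rw [add_mk_zero_right]
      exact h _)
  simpa [fourierMode] using this

theorem hasFDerivAt_fourierMode {f : ℝ × ℝ → ℂ} (hf : ContDiff ℝ (⊤ : ℕ∞) f) (l : ℤ)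
    (z : ℝ × ℝ) :
    HasFDerivAt (fourierMode l f)
      (∫ s in (0:ℝ)..1, Complex.exp (-(2 * π * Complex.I * l * s)) • fderiv ℝ f (z + (s, 0))) z := by
  have hf' : Continuous (fderiv ℝ f) := hf.continuous_fderiv (by simp)
  have hfc : Continuous f := hf.continuous
  obtain ⟨M, hM⟩ := (isCompact_closedBall z 2).exists_bound_of_continuousOn hf'.continuousOn
  refine intervalIntegral.hasFDerivAt_integral_of_dominated_of_fderiv_le
    (F' := fun (z : ℝ × ℝ) (s : ℝ) =>
      Complex.exp (-(2 * π * Complex.I * l * s)) • fderiv ℝ f (z + (s, 0)))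
    (bound := fun _ => M) (Metric.ball_mem_nhds z one_pos) ?_ ?_ ?_ ?_ ?_ ?_
  · exact Filter.Eventually.of_forall fun z => Continuous.aestronglyMeasurable (by fun_prop)
  · exact Continuous.intervalIntegrable (by fun_prop) _ _
  · exact Continuous.aestronglyMeasurable (by fun_prop)
  · refine Filter.Eventually.of_forall fun s hs w hw => ?_
    rw [Set.uIoc_of_le zero_le_one] at hs
    rw [norm_smul, norm_exp_neg_two_pi_I_mul, one_mul]
    refine hM _ ?_
    rw [Metric.mem_ball, dist_eq_norm] at hw
    rw [Metric.mem_closedBall, dist_eq_norm, add_sub_right_comm]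
    refine (norm_add_le _ _).trans ?_
    have : ‖((s, 0) : ℝ × ℝ)‖ ≤ 1 := by
      simp [Prod.norm_def, abs_of_pos hs.1, hs.2]
    linarith
  · exact intervalIntegrable_const
  · refine Filter.Eventually.of_forall fun s _ w _ => ?_
    have h := (hf.differentiable (by simp) (w + (s, 0))).hasFDerivAt
    exact ((hasFDerivAt_comp_add_right (s, 0)).2 h).const_mul _

theorem dirDeriv_fourierMode {f : ℝ × ℝ → ℂ} (hf : ContDiff ℝ (⊤ : ℕ∞) f) (l : ℤ)
    (v : ℝ × ℝ) : dirDeriv v (fourierMode l f) = fourierMode l (dirDeriv v f) := by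
  funext z
  have hf' : Continuous (fderiv ℝ f) := hf.continuous_fderiv (by simp)
  rw [dirDeriv, (hasFDerivAt_fourierMode hf l z).fderiv,
    ContinuousLinearMap.intervalIntegral_apply
      (Continuous.intervalIntegrable (by fun_prop) _ _)]
  rfl

theorem contDiff_fourierMode {f : ℝ × ℝ → ℂ} (hf : ContDiff ℝ (⊤ : ℕ∞) f) (l : ℤ) :
    ContDiff ℝ (⊤ : ℕ∞) (fourierMode l f) := by
  refine contDiff_of_closed_dirDeriv
    (S := {F | ∃ f, ContDiff ℝ (⊤ : ℕ∞) f ∧ F = fourierMode l f}) ?_ ⟨f, hf, rfl⟩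
  rintro _ ⟨f, hf, rfl⟩
  exact ⟨fun z => (hasFDerivAt_fourierMode hf l z).differentiableAt,
    ⟨_, contDiff_dirDeriv hf _, dirDeriv_fourierMode hf l _⟩,
    ⟨_, contDiff_dirDeriv hf _, dirDeriv_fourierMode hf l _⟩⟩

theorem multiDeriv_fourierMode {f : ℝ × ℝ → ℂ} (hf : ContDiff ℝ (⊤ : ℕ∞) f) (l : ℤ)
    (vs : List (ℝ × ℝ)) : multiDeriv vs (fourierMode l f) = fourierMode l (multiDeriv vs f) := by
  induction vs with
  | nil => rfl
  | cons v vs ih =>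
    change dirDeriv v (multiDeriv vs _) = _
    rw [ih, dirDeriv_fourierMode (contDiff_multiDeriv hf vs)]
    rfl

theorem mixedDeriv_periodic {f : ℝ × ℝ → ℂ} (hp : ∀ t u : ℝ, f (t + 1, u) = f (t, u))
    (β α : ℕ) (t u : ℝ) : mixedDeriv β α f (t + 1, u) = mixedDeriv β α f (t, u) := by
  have h : (fun z => f (z + (1, 0))) = f := by
    funext z
    simp [add_mk_zero_right, hp]
  have h' := multiDeriv_comp_add_right f (1, 0)
    (List.replicate β ((1:ℝ), (0:ℝ)) ++ List.replicate α ((0:ℝ), (1:ℝ)))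
  rw [h] at h'
  simpa [mixedDeriv] using (congrFun h' (t, u)).symm

theorem hasDerivAt_exp_neg_two_pi_I_mul (l : ℤ) (s : ℝ) :
    HasDerivAt (fun s : ℝ => Complex.exp (-(2 * π * Complex.I * l * s)))
      (-(2 * π * Complex.I * l) * Complex.exp (-(2 * π * Complex.I * l * s))) s := by
  have h : HasDerivAt (fun s : ℝ => -(2 * π * Complex.I * l * (s : ℂ)))
      (-(2 * π * Complex.I * l)) s := by
    simpa using ((Complex.ofRealCLM.hasDerivAt (x := s)).const_mul (2 * π * Complex.I * l)).fun_neg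
  simpa [mul_comm] using h.cexp

theorem fourierMode_dirDeriv_fst {f : ℝ × ℝ → ℂ} (hf : ContDiff ℝ (⊤ : ℕ∞) f)
    (hp : ∀ t u : ℝ, f (t + 1, u) = f (t, u)) (l : ℤ) (z : ℝ × ℝ) :
    fourierMode l (dirDeriv (1, 0) f) z = 2 * π * Complex.I * l * fourierMode l f z := by
  have hv : ∀ s : ℝ, HasDerivAt (fun s : ℝ => f (z + (s, 0))) (dirDeriv (1, 0) f (z + (s, 0))) s := by
    intro s
    have h1 : HasDerivAt (fun s : ℝ => z + (s, 0)) ((1 : ℝ), (0 : ℝ)) s :=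
      ((hasDerivAt_id s).prodMk (hasDerivAt_const s (0 : ℝ))).const_add z
    exact (hf.differentiable (by simp) _).hasFDerivAt.comp_hasDerivAt s h1
  have hdc : Continuous (dirDeriv (1, 0) f) := (contDiff_dirDeriv hf _).continuous
  have h := intervalIntegral.integral_mul_deriv_eq_deriv_mul (a := 0) (b := 1)
    (fun s _ => hasDerivAt_exp_neg_two_pi_I_mul l s) (fun s _ => hv s)
    (Continuous.intervalIntegrable (by fun_prop) _ _)
    (Continuous.intervalIntegrable (by fun_prop) _ _)
  have h1 : Complex.exp (-(2 * π * Complex.I * l)) = 1 := by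
    rw [Complex.exp_eq_one_iff]
    exact ⟨-l, by push_cast; ring⟩
  have h2 : f (z + (1, 0)) = f z := by simp [add_mk_zero_right, hp]
  have h3 : z + ((0 : ℝ), (0 : ℝ)) = z := add_zero z
  simp only [Complex.ofReal_one, Complex.ofReal_zero, mul_one, mul_zero, neg_zero,
    Complex.exp_zero, h1, h2, h3, one_mul, sub_self, zero_sub, mul_assoc (-_ : ℂ),
    intervalIntegral.integral_const_mul] at h
  rw [fourierMode, fourierMode, h]
  ring

theorem IsCircleSymbol.rapidFamily_fourierMode {m : ℝ} {f : ℝ × ℝ → ℂ} (hf : IsCircleSymbol m f) :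
    RapidFamily m (fun l => fourierMode l f) where
  smooth l := contDiff_fourierMode hf.smooth l
  est β α N := by
    have key : ∀ l, mixedDeriv β α (fourierMode l f) = fourierMode l (mixedDeriv β α f) :=
      fun l => multiDeriv_fourierMode hf.smooth l _
    simp only [key]
    clear key
    induction N generalizing β with
    | zero =>
      obtain ⟨C, hC⟩ := hf.est β α
      refine ⟨C, fun l z => ?_⟩
      rw [pow_zero, one_mul]
      exact norm_fourierMode_le l z fun t => hC (t, z.2)
    | succ N ih =>
      obtain ⟨C, hC⟩ := ih β
      obtain ⟨C', hC'⟩ := ih (β + 1)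
      refine ⟨C + C', fun l z => ?_⟩
      have h1 := hC l z
      have h2 := hC' l z
      rw [mixedDeriv_succ_left, fourierMode_dirDeriv_fst (contDiff_mixedDeriv hf.smooth β α)
        (mixedDeriv_periodic hf.periodic β α), norm_mul] at h2
      have h3 : |(l : ℝ)| ≤ ‖(2 * π * Complex.I * l : ℂ)‖ := by
        simp only [norm_mul, Complex.norm_I, Complex.norm_intCast, Complex.norm_real,
          Complex.norm_ofNat, mul_one, norm_of_nonneg pi_pos.le]
        nlinarith [pi_gt_three, abs_nonneg (l : ℝ)]
      rw [add_mul]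
      refine le_trans ?_ (add_le_add h1 h2)
      rw [← mul_add, pow_succ, mul_assoc]
      gcongr
      rw [add_mul, one_mul]
      gcongr

theorem fourierMode_eq_exp_mul {f : ℝ × ℝ → ℂ} (hp : ∀ t u : ℝ, f (t + 1, u) = f (t, u))
    (l : ℤ) (t u : ℝ) :
    fourierMode l f (t, u) =
      Complex.exp (2 * π * Complex.I * l * t) * fourierMode l f (0, u) := by
  have hper : Function.Periodic
      (fun s : ℝ => Complex.exp (-(2 * π * Complex.I * l * s)) * f (s, u)) 1 := by
    intro s
    simp only [hp]
    congr 1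
    rw [Complex.exp_eq_exp_iff_exists_int]
    exact ⟨-l, by push_cast; ring⟩
  have h := hper.intervalIntegral_add_eq t 0
  have h' := intervalIntegral.integral_comp_add_left
    (fun s : ℝ => Complex.exp (-(2 * π * Complex.I * l * s)) * f (s, u)) (a := 0) (b := 1) t
  simp only [add_zero, zero_add] at h h'
  simp only [fourierMode, Prod.mk_add_mk, add_zero, zero_add]
  rw [← h, ← h', ← intervalIntegral.integral_const_mul]
  congr 1
  funext s
  rw [← mul_assoc, ← Complex.exp_add]
  push_cast
  ring_nf

theorem IsCircleSymbol.hasSum_fourierMode {m : ℝ} {f : ℝ × ℝ → ℂ} (hf : IsCircleSymbol m f)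
    (z : ℝ × ℝ) : HasSum (fun l => fourierMode l f z) (f z) := by
  have hper : Function.Periodic (fun s : ℝ => f (z + (s, 0))) 1 := by
    intro s
    simp [add_mk_zero_right, ← add_assoc, hf.periodic]
  have hfc := hf.smooth.continuous
  have hc : Continuous hper.lift := continuous_coinduced_dom.2 (by
    change Continuous (fun s : ℝ => f (z + (s, 0)))
    fun_prop)
  let g : C(AddCircle (1 : ℝ), ℂ) := ⟨hper.lift, hc⟩
  have hg : fourierCoeff g = fun l => fourierMode l f z := by
    funext l
    rw [fourierCoeff_eq_intervalIntegral _ l 0, fourierMode]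
    simp only [zero_add, div_one, one_smul, smul_eq_mul]
    congr 1
    funext s
    rw [fourier_coe_apply]
    congr 2
    push_cast
    ring
  have h := has_pointwise_sum_fourier_series_of_summable (f := g)
    (by rw [hg]; exact hf.rapidFamily_fourierMode.summable_apply z) ((0 : ℝ) : AddCircle (1 : ℝ))
  have h0 : g ((0 : ℝ) : AddCircle (1 : ℝ)) = f z := by
    change f (z + (0, 0)) = f z
    exact congrArg f (add_zero z)
  rw [h0, hg] at h
  simpa using h

theorem one_add_abs_add_rpow_le {r : ℝ} (hr : r ≤ 0) {q : ℕ} (hq : -r ≤ q) (u v : ℝ) :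
    (1 + |u + v|) ^ r ≤ (1 + |v|) ^ q * (1 + |u|) ^ r := by
  have h : 1 + |u| ≤ (1 + |u + v|) * (1 + |v|) := by
    have h1 : |u| ≤ |u + v| + |v| := by simpa using abs_sub (u + v) v
    nlinarith [mul_nonneg (abs_nonneg (u + v)) (abs_nonneg v)]
  have h2 := rpow_le_rpow_of_nonpos (by positivity) h hr
  rw [mul_rpow (by positivity) (by positivity)] at h2
  have h3 : (1 : ℝ) ≤ (1 + |v|) ^ q * (1 + |v|) ^ r := by
    rw [← rpow_natCast, ← rpow_add (by positivity)]
    exact one_le_rpow (by linarith [abs_nonneg v]) (by linarith)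
  calc (1 + |u + v|) ^ r ≤ (1 + |u + v|) ^ r * ((1 + |v|) ^ q * (1 + |v|) ^ r) :=
        le_mul_of_one_le_right (by positivity) h3
    _ = (1 + |v|) ^ q * ((1 + |u + v|) ^ r * (1 + |v|) ^ r) := by ring
    _ ≤ _ := by gcongr

theorem IsCircleSymbol.moderateFamily_sub_translate {m : ℝ} (hm : m ≤ 0) {a : ℝ × ℝ → ℂ}
    (ha : IsCircleSymbol m a) :
    ModerateFamily (m - 1) (fun l z => a z - a (z + (0, 2 * π * l))) where
  smooth l := ha.smooth.sub (ha.smooth.comp (contDiff_id.add contDiff_const))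
  est β α := by
    have hst : ∀ w : ℝ × ℝ, ContDiff ℝ (⊤ : ℕ∞) (fun z => a (z + w)) :=
      fun w => ha.smooth.comp (contDiff_id.add contDiff_const)
    obtain ⟨C, hC⟩ := ha.est β (α + 1)
    change ∀ z, ‖mixedDeriv β (α + 1) a z‖ ≤ _ at hC
    have hr : m - ((α + 1 : ℕ) : ℝ) = m - 1 - α := by push_cast; ring
    rw [hr] at hC
    have hC0 : 0 ≤ C := by
      have h := hC (0, 0)
      simp only [abs_zero, add_zero, one_rpow, mul_one] at h
      exact (norm_nonneg _).trans h
    obtain ⟨q, hq⟩ := exists_nat_ge (-(m - 1 - (α : ℝ)))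
    have hr0 : m - 1 - (α : ℝ) ≤ 0 := by linarith [(Nat.cast_nonneg α : (0:ℝ) ≤ α)]
    refine ⟨C * 8 ^ (q + 1), q + 1, fun l z => ?_⟩
    set h : ℝ := 2 * π * l with hh
    set P := mixedDeriv β α a with hP
    have hPs : ContDiff ℝ (⊤ : ℕ∞) P := contDiff_mixedDeriv ha.smooth β α
    have key : mixedDeriv β α (fun z => a z - a (z + (0, h))) z = P z - P (z + (0, h)) := by
      have h1 := multiDeriv_sub ha.smooth (hst (0, h))
        (List.replicate β ((1:ℝ), (0:ℝ)) ++ List.replicate α ((0:ℝ), (1:ℝ)))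
      rw [multiDeriv_comp_add_right] at h1
      exact congrFun h1 z
    have hd : ∀ s : ℝ, HasDerivAt (fun s : ℝ => P (z + (0, s * h)))
        (h • mixedDeriv β (α + 1) a (z + (0, s * h))) s := by
      intro s
      have h1 : HasDerivAt (fun s : ℝ => z + (0, s * h)) ((0 : ℝ), h) s :=
        ((hasDerivAt_const s (0 : ℝ)).prodMk
          (by simpa using (hasDerivAt_id s).mul_const h)).const_add z
      have h2 := (hPs.differentiable (by simp) (z + (0, s * h))).hasFDerivAt.comp_hasDerivAt s h1
      rw [← dirDeriv_snd_mixedDeriv ha.smooth, dirDeriv, ← map_smul,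
        show h • ((0 : ℝ), (1 : ℝ)) = (0, h) by simp]
      exact h2
    have hlen : 1 + |h| ≤ 8 * (1 + |(l : ℝ)|) := by
      rw [hh, abs_mul, abs_of_pos two_pi_pos]
      nlinarith [pi_lt_four, abs_nonneg (l : ℝ)]
    have hb : ∀ s ∈ Set.Ico (0 : ℝ) 1, ‖h • mixedDeriv β (α + 1) a (z + (0, s * h))‖
        ≤ C * 8 ^ (q + 1) * (1 + |(l : ℝ)|) ^ (q + 1) * (1 + |z.2|) ^ (m - 1 - (α : ℝ)) := by
      intro s hs
      have hsh : |s * h| ≤ |h| := by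
        rw [abs_mul, abs_of_nonneg hs.1]
        exact mul_le_of_le_one_left (abs_nonneg _) hs.2.le
      have h1 : ‖mixedDeriv β (α + 1) a (z + (0, s * h))‖
          ≤ C * ((8 * (1 + |(l : ℝ)|)) ^ q * (1 + |z.2|) ^ (m - 1 - (α : ℝ))) := by
        refine (hC _).trans (mul_le_mul_of_nonneg_left ?_ hC0)
        refine (one_add_abs_add_rpow_le hr0 hq z.2 (s * h)).trans ?_
        gcongr
        linarith
      rw [norm_smul, norm_eq_abs]
      calc |h| * ‖mixedDeriv β (α + 1) a (z + (0, s * h))‖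
          ≤ (8 * (1 + |(l : ℝ)|)) *
            (C * ((8 * (1 + |(l : ℝ)|)) ^ q * (1 + |z.2|) ^ (m - 1 - (α : ℝ)))) := by
            gcongr
            linarith
        _ = _ := by rw [mul_pow, pow_succ, pow_succ]; ring
    have hmv := norm_image_sub_le_of_norm_deriv_le_segment_01'
      (fun s _ => (hd s).hasDerivWithinAt) hb
    have hz : z + ((0 : ℝ), (0 : ℝ)) = z := add_zero z
    rw [one_mul, zero_mul, hz, norm_sub_rev] at hmv
    rwa [key]

theorem exists_L2I_ae_eq {f : ℝ → ℂ} (hf : Continuous f) {C : ℝ} (hC : ∀ t, ‖f t‖ ≤ C) :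
    ∃ g : L2I, g =ᵐ[volume.restrict (Set.Ioo (0:ℝ) 1)] f :=
  ⟨BoundedContinuousFunction.toLp 2 _ ℂ (BoundedContinuousFunction.ofNormedAddCommGroup f hf C hC),
    BoundedContinuousFunction.coeFn_toLp ..⟩

/-- A uniformly summable series of bounded continuous functions converges in `L²(0,1)` to its
pointwise sum. -/
theorem exists_hasSum_L2I {f : ℤ → ℝ → ℂ} (hf : ∀ l, Continuous (f l)) {w : ℤ → ℝ}
    (hw : Summable w) (hb : ∀ l t, ‖f l t‖ ≤ w l) {F : ℤ → L2I}
    (hF : ∀ l, F l =ᵐ[volume.restrict (Set.Ioo (0:ℝ) 1)] f l) :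
    ∃ G : L2I, HasSum F G ∧
      G =ᵐ[volume.restrict (Set.Ioo (0:ℝ) 1)] fun t => ∑' l, f l t := by
  let φ : ℤ → BoundedContinuousFunction ℝ ℂ := fun l =>
    BoundedContinuousFunction.ofNormedAddCommGroup (f l) (hf l) (w l) (hb l)
  have hφ : Summable φ := Summable.of_norm_bounded hw fun l =>
    BoundedContinuousFunction.norm_ofNormedAddCommGroup_le (hf l)
      ((norm_nonneg _).trans (hb l 0)) (hb l)
  let T := BoundedContinuousFunction.toLp (E := ℂ) 2 (volume.restrict (Set.Ioo (0:ℝ) 1)) ℂ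
  have hFT : F = fun l => T (φ l) := by
    funext l
    exact Lp.ext ((hF l).trans (BoundedContinuousFunction.coeFn_toLp 2 _ ℂ (φ l)).symm)
  refine ⟨T (∑' l, φ l), hFT ▸ hφ.hasSum.mapL T, ?_⟩
  refine (BoundedContinuousFunction.coeFn_toLp 2 _ ℂ (∑' l, φ l)).trans ?_
  refine Filter.Eventually.of_forall fun t => ?_
  exact ((BoundedContinuousFunction.evalCLM ℂ t).map_tsum hφ)

theorem IsCircleSymbol.exists_norm_le {m : ℝ} (hm : m ≤ 0) {a : ℝ × ℝ → ℂ}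
    (ha : IsCircleSymbol m a) : ∃ M : ℝ, ∀ z, ‖a z‖ ≤ M := by
  obtain ⟨C, hC⟩ := ha.est 0 0
  refine ⟨C, fun z => (hC z).trans (mul_le_of_le_one_right ?_ ?_)⟩
  · have h := hC (0, 0)
    simp only [abs_zero, add_zero, one_rpow, mul_one] at h
    exact (norm_nonneg _).trans h
  · exact rpow_le_one_of_one_le_of_nonpos (by linarith [abs_nonneg z.2]) (by simpa using hm)

/-- The function `e_k^θ(t) = e^{2πi(k+θ)t}`. -/
def modeExp (θ : ℝ) (k : ℤ) (t : ℝ) : ℂ :=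
  Complex.exp (2 * (π : ℂ) * Complex.I * ((k : ℂ) + (θ : ℂ)) * (t : ℂ))

theorem continuous_modeExp (θ : ℝ) (k : ℤ) : Continuous (modeExp θ k) := by
  unfold modeExp
  fun_prop

theorem norm_modeExp (θ : ℝ) (k : ℤ) (t : ℝ) : ‖modeExp θ k t‖ = 1 := by
  have h := norm_exp_two_pi_I_mul (k + θ) t
  push_cast at h
  exact h

theorem modeExp_add (θ : ℝ) (k l : ℤ) (t : ℝ) :
    modeExp θ (k + l) t = Complex.exp (2 * π * Complex.I * l * t) * modeExp θ k t := by
  rw [modeExp, modeExp, ← Complex.exp_add]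
  push_cast
  ring_nf

/-- The action of `λ̃_θ(a) λ̃_θ(b)` on the basis vector `e_k^θ`. -/
theorem IsLambdaTilde.comp_apply_ae_eq {m m' : ℝ} (hm : m ≤ 0) {a b : ℝ × ℝ → ℂ}
    (ha : IsCircleSymbol m a) (hb : IsCircleSymbol m' b) {A B : ℝ → (L2I →L[ℂ] L2I)}
    (hA : IsLambdaTilde a A) (hB : IsLambdaTilde b B) {θ : ℝ} {k : ℤ} {g : L2I}
    (hg : RepsExp θ k g) :
    A θ (B θ g) =ᵐ[volume.restrict (Set.Ioo (0:ℝ) 1)] fun t =>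
      ∑' l : ℤ, fourierMode l b (t, 2 * π * (k + θ)) *
        a ((t, 2 * π * (k + θ)) + (0, 2 * π * l)) * modeExp θ k t := by
  set u : ℝ := 2 * π * (k + θ) with hu
  obtain ⟨M, hM⟩ := ha.exists_norm_le hm
  obtain ⟨C, -, hC⟩ := hb.rapidFamily_fourierMode.exists_norm_le 0 0
  simp only [mixedDeriv_zero_zero] at hC
  have hac := ha.smooth.continuous
  have hec := continuous_modeExp θ k
  have hKc : ∀ l, Continuous (fourierMode l b) := fun l =>
    (contDiff_fourierMode hb.smooth l).continuous
  have hM0 : 0 ≤ M := (norm_nonneg _).trans (hM 0)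
  have hw : Summable fun l : ℤ =>
      C * (1 + |u|) ^ (m' - ((0 : ℕ) : ℝ)) * ((1 + |(l : ℝ)|) ^ 2)⁻¹ :=
    summable_inv_one_add_abs_sq.mul_left _
  choose e he using fun l : ℤ =>
    exists_L2I_ae_eq (continuous_modeExp θ (k + l)) (fun t => (norm_modeExp θ (k + l) t).le)
  have hF : ∀ l, (fourierMode l b (0, u) • e l : L2I) =ᵐ[volume.restrict (Set.Ioo (0:ℝ) 1)]
      fun t => fourierMode l b (t, u) * modeExp θ k t := by
    intro l
    filter_upwards [Lp.coeFn_smul (fourierMode l b (0, u)) (e l), he l] with t h1 h2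
    rw [h1, Pi.smul_apply, h2, smul_eq_mul, modeExp_add, fourierMode_eq_exp_mul hb.periodic l t u]
    ring
  have hAF : ∀ l, A θ (fourierMode l b (0, u) • e l)
      =ᵐ[volume.restrict (Set.Ioo (0:ℝ) 1)]
      fun t => fourierMode l b (t, u) * a ((t, u) + (0, 2 * π * l)) * modeExp θ k t := by
    intro l
    rw [map_smul]
    filter_upwards [Lp.coeFn_smul (fourierMode l b (0, u)) (A θ (e l)), hA θ (k + l) (e l) (he l)]
      with t h1 h2
    change _ = _ * modeExp θ (k + l) t at h2
    have h3 : ((t, u) + (0, 2 * π * l) : ℝ × ℝ) = (t, 2 * π * (((k + l : ℤ) : ℝ) + θ)) := by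
      rw [hu]
      ext
      · simp
      · simp only [Prod.snd_add]
        push_cast
        ring
    rw [h1, Pi.smul_apply, h2, smul_eq_mul, modeExp_add,
      fourierMode_eq_exp_mul hb.periodic l t u, h3]
    ring
  obtain ⟨G, hG, hG'⟩ := exists_hasSum_L2I (w := fun l => _)
    (fun l => by have := hKc l; fun_prop) hw
    (fun l t => by rw [norm_mul, norm_modeExp, mul_one]; exact hC l (t, u)) hF
  obtain ⟨G₂, hG₂, hG₂'⟩ := exists_hasSum_L2I (w := fun l => _)
    (fun l => by have := hKc l; fun_prop) (hw.mul_right M)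
    (fun l t => by
      rw [norm_mul, norm_modeExp, mul_one, norm_mul]
      exact mul_le_mul (hC l (t, u)) (hM _) (norm_nonneg _) ((norm_nonneg _).trans (hC l (t, u))))
    hAF
  have hGB : G = B θ g := by
    refine Lp.ext (hG'.trans ?_)
    filter_upwards [hB θ k g hg] with t ht
    rw [ht, tsum_mul_right, (hb.hasSum_fourierMode (t, u)).tsum_eq]
    rfl
  rw [← hGB, (hG.mapL (A θ)).unique hG₂]
  exact hG₂'

/-- `λ̃` is multiplicative up to lower order terms:
`λ̃(ab) − λ̃(a) λ̃(b) ∈ λ̃(S^{m+m'−1}(S¹))`. -/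
theorem statement10 (m m' : ℝ) (hm : m ≤ 0) (hm' : m' ≤ 0)
    (a b : ℝ × ℝ → ℂ) (ha : IsCircleSymbol m a) (hb : IsCircleSymbol m' b)
    (A B D : ℝ → (L2I →L[ℂ] L2I))
    (hA : IsLambdaTilde a A) (hB : IsLambdaTilde b B)
    (hD : IsLambdaTilde (fun z => a z * b z) D) :
    ∃ c : ℝ × ℝ → ℂ, IsCircleSymbol (m + m' - 1) c ∧
      ∃ E : ℝ → (L2I →L[ℂ] L2I), IsLambdaTilde c E ∧
        ∀ θ : ℝ, D θ - A θ * B θ = E θ := by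
  have hfam := hb.rapidFamily_fourierMode.mul_moderate (ha.moderateFamily_sub_translate hm)
  rw [show m' + (m - 1) = m + m' - 1 by ring] at hfam
  refine ⟨_, hfam.isCircleSymbol_tsum (by linarith) ?_, fun θ => D θ - A θ * B θ, ?_, fun _ => rfl⟩
  · intro l t u
    have hK := mixedDeriv_periodic (f := fourierMode l b)
      (fun t u => by
        simp only [fourierMode, add_mk_zero_right, add_right_comm t 1, hb.periodic]) 0 0 t u
    simp only [mixedDeriv_zero_zero] at hK
    simp [hK, ha.periodic]
  · intro θ k g hg
    filter_upwards [hD θ k g hg, IsLambdaTilde.comp_apply_ae_eq hm ha hb hA hB hg,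
      Lp.coeFn_sub (D θ g) (A θ (B θ g))] with t h1 h2 h3
    change (D θ g - A θ (B θ g) : L2I) t = _
    have hs := (hb.hasSum_fourierMode (t, 2 * π * (k + θ))).mul_right (a (t, 2 * π * (k + θ)))
    have hs' := hfam.summable_apply (t, 2 * π * (k + θ))
    have h4 := hs.summable.tsum_sub hs'
    rw [hs.tsum_eq] at h4
    simp only [Pi.mul_apply, ← mul_sub, sub_sub_cancel] at h4
    rw [h3, Pi.sub_apply, h1, h2, tsum_mul_right, h4]
    simp only [modeExp, Pi.mul_apply]
    ring

end
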